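/- arXiv:2211.15796 — 4 statements merged into one kernel-verified Lean document; each statement's English description precedes it below -/
import Mathlib

section
/- Let G be a simple graph on vertex set [n]={1,...,n} such that N_G(C) = [n] for every odd cycle C of G, where N_G(C) is the set of vertices adjacent to some vertex of C. Then for every integer s ≥ 1, the s-th symbolic power of the vertex cover ideal satisfies J(G)^(s) = J(G)^s + Σ_{i=1}^{⌊s/2⌋} (x_1 x_2 ··· x_n)^i · J(G)^{s−2i}. -/
/-!
STATEMENT 4: Let `G` be a simple graph on `[n]` such that `N_G(C) = [n]` for every odd
cycle `C` of `G`.  Then for every `s ≥ 1`,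
`J(G)^{(s)} = J(G)^s + Σ_{i=1}^{⌊s/2⌋} (x_1 ⋯ x_n)^i · J(G)^{s-2i}`.
-/
open MvPolynomial

namespace Stmt

variable (K : Type) [Field K]

/-- `F` is a vertex cover of the graph `G`. -/
def IsVertexCover {V : Type} (G : SimpleGraph V) (F : Finset V) : Prop :=
  ∀ v w, G.Adj v w → v ∈ F ∨ w ∈ F

/-- `F` is a minimal vertex cover of the graph `G`. -/
def IsMinimalVertexCover {V : Type} (G : SimpleGraph V) (F : Finset V) : Prop :=
  IsVertexCover G F ∧ ∀ F' ⊆ F, IsVertexCover G F' → F' = F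

/-- The vertex cover ideal `J(G)`, generated by the monomials `∏_{v ∈ F} x_v`
with `F` a minimal vertex cover of `G`. -/
noncomputable def coverIdeal {V : Type} (G : SimpleGraph V) : Ideal (MvPolynomial V K) :=
  Ideal.span { m | ∃ F : Finset V, IsMinimalVertexCover G F ∧ m = ∏ v ∈ F, X v }

/-- The `s`-th symbolic power `J(G)^{(s)} = ⋂_{{v,w} ∈ E(G)} (x_v, x_w)^s`. -/
noncomputable def symbolicCoverPower {V : Type} (G : SimpleGraph V) (s : ℕ) :
    Ideal (MvPolynomial V K) :=
  ⨅ (v : V) (w : V) (_ : G.Adj v w), (Ideal.span {X v, X w} : Ideal (MvPolynomial V K)) ^ s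

theorem IsVertexCover.exists_isMinimalVertexCover {V : Type} {G : SimpleGraph V} {F : Finset V}
    (hF : IsVertexCover G F) : ∃ F' ⊆ F, IsMinimalVertexCover G F' := by
  obtain ⟨F', hle, hmin⟩ := exists_minimal_le_of_wellFoundedLT (IsVertexCover G) F hF
  exact ⟨F', hle, hmin.prop, fun E hE hEc => hmin.eq_of_le hEc hE⟩

theorem prod_X_mem_coverIdeal {V : Type} {G : SimpleGraph V} {F : Finset V}
    (hF : IsVertexCover G F) :
    ∏ v ∈ F, (X v : MvPolynomial V K) ∈ coverIdeal K G := by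
  obtain ⟨F', hsub, hmin⟩ := hF.exists_isMinimalVertexCover
  exact Ideal.mem_of_dvd _ (Finset.prod_dvd_prod_of_subset _ _ _ hsub)
    (Ideal.subset_span ⟨F', hmin, rfl⟩)

/-- A graph without odd cycles has no odd closed walk: bypassing repeated vertices preserves the
parity of the length. -/
theorem even_length_bypass_iff {V : Type} [DecidableEq V] {G : SimpleGraph V}
    (hG : ∀ (v : V) (c : G.Walk v v), c.IsCycle → Even c.length) {u v : V} (p : G.Walk u v) :
    Even p.bypass.length ↔ Even p.length := by
  induction p with
  | nil => simp [SimpleGraph.Walk.bypass]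
  | @cons u v w h p ih =>
    simp only [SimpleGraph.Walk.bypass, SimpleGraph.Walk.length_cons]
    split_ifs with hu
    · have hlen : (p.bypass.takeUntil u hu).length + (p.bypass.dropUntil u hu).length
          = p.bypass.length := by
        rw [← SimpleGraph.Walk.length_append, SimpleGraph.Walk.take_spec]
      have hodd : Odd (p.bypass.takeUntil u hu).length := by
        by_contra hne
        rw [Nat.not_odd_iff_even] at hne
        have hpos : (p.bypass.takeUntil u hu).length ≠ 0 := fun h0 =>
          h.ne (SimpleGraph.Walk.eq_of_length_eq_zero h0).symm
        have hcyc : (SimpleGraph.Walk.cons h (p.bypass.takeUntil u hu)).IsCycle := by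
          rw [SimpleGraph.Walk.isCycle_iff_isPath_tail_and_le_length]
          refine ⟨?_, ?_⟩
          · simpa using p.bypass_isPath.takeUntil hu
          · obtain ⟨k, hk⟩ := hne
            simp only [SimpleGraph.Walk.length_cons]
            omega
        have := hG _ _ hcyc
        rw [SimpleGraph.Walk.length_cons, Nat.even_add_one] at this
        exact this hne
      have hne := Nat.not_even_iff_odd.2 hodd
      rw [Nat.even_add_one, ← ih, ← hlen, Nat.even_add]
      tauto
    · rw [SimpleGraph.Walk.length_cons, Nat.even_add_one, Nat.even_add_one, ih]

theorem two_colorable_of_forall_isCycle_even {V : Type} {G : SimpleGraph V}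
    (hG : ∀ (v : V) (c : G.Walk v v), c.IsCycle → Even c.length) : G.Colorable 2 := by
  classical
  refine SimpleGraph.two_colorable_iff_forall_loop_even.2 fun u w => ?_
  rw [← even_length_bypass_iff hG,
    (SimpleGraph.Walk.isPath_iff_nil.1 w.bypass_isPath).eq_nil]
  simp

/-- If every odd cycle passes through a vertex of weight at least `s`, then a vertex cover can be
split off from an `s`-cover, leaving an `(s - 1)`-cover. -/
theorem exists_isVertexCover_split {V : Type} [Fintype V] [DecidableEq V]
    {G : SimpleGraph V} {s : ℕ} (hs : 1 ≤ s) {a : V → ℕ} (ha : ∀ v w, G.Adj v w → s ≤ a v + a w)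
    (hcyc : ∀ (v : V) (c : G.Walk v v), c.IsCycle → Odd c.length → ∃ w ∈ c.support, s ≤ a w) :
    ∃ (F : Finset V) (b : V → ℕ), IsVertexCover G F ∧
      (∀ v, a v = (if v ∈ F then 1 else 0) + b v) ∧
      ∀ v w, G.Adj v w → s - 1 ≤ b v + b w := by
  classical
  let B : Set V := {v | a v < s}
  have hcol : (G.induce B).Colorable 2 := by
    refine two_colorable_of_forall_isCycle_even fun v c hc => ?_
    by_contra hne
    obtain ⟨w, hw, hsw⟩ := hcyc _ (c.map (SimpleGraph.Embedding.induce B).toHom)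
      (hc.map Subtype.val_injective)
      (by rw [SimpleGraph.Walk.length_map]; exact Nat.not_even_iff_odd.1 hne)
    rw [SimpleGraph.Walk.support_map, List.mem_map] at hw
    obtain ⟨x, -, rfl⟩ := hw
    have hx : a x < s := x.2
    exact absurd hsw (not_le.2 hx)
  obtain ⟨C⟩ := hcol
  let F : Finset V := {v | s ≤ a v ∨ ∃ h : a v < s, 0 < a v ∧ C ⟨v, h⟩ = 0}
  have hF : ∀ v, v ∈ F ↔ s ≤ a v ∨ ∃ h : a v < s, 0 < a v ∧ C ⟨v, h⟩ = 0 := fun v => by simp [F]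
  have hpos : ∀ v ∈ F, 0 < a v := fun v hv => by
    rcases (hF v).1 hv with h | ⟨_, h, _⟩ <;> omega
  have hvalid : ∀ v w (hv : a v < s) (hw : a w < s), G.Adj v w → C ⟨v, hv⟩ ≠ C ⟨w, hw⟩ :=
    fun v w hv hw h => C.valid (show (G.induce B).Adj ⟨v, hv⟩ ⟨w, hw⟩ from h)
  refine ⟨F, fun v => a v - if v ∈ F then 1 else 0, ?_, ?_, ?_⟩
  · intro v w h
    have hvw := ha v w h
    by_contra! hnot
    simp only [hF, not_or, not_exists, not_and, not_le] at hnot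
    obtain ⟨⟨hv, hv'⟩, hw, hw'⟩ := hnot
    have h1 := hvalid v w hv hw h
    have h2 := hv' hv (by omega)
    have h3 := hw' hw (by omega)
    omega
  · intro v
    have := hpos v
    dsimp only
    split_ifs with hv
    · have := this hv
      omega
    · omega
  · intro v w h
    have hvw := ha v w h
    have hv := hpos v
    have hw := hpos w
    dsimp only
    by_cases hboth : v ∈ F ∧ w ∈ F
    · have hlt : s < a v + a w := by
        have hv := hv hboth.1
        have hw := hw hboth.2
        rcases (hF v).1 hboth.1 with h1 | ⟨h1, -, hc1⟩
        · omega
        · rcases (hF w).1 hboth.2 with h2 | ⟨h2, -, hc2⟩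
          · omega
          · exact absurd (hc1.trans hc2.symm) (hvalid v w h1 h2 h)
      have := hv hboth.1
      have := hw hboth.2
      rw [if_pos hboth.1, if_pos hboth.2]
      omega
    · split_ifs <;> first | omega | tauto

/-- Under the odd cycle condition, the monomial of an `s`-cover factors through a power of
`∏ v, X v` and a product of vertex covers. -/
theorem exists_prod_pow_mem {V : Type} [Fintype V] {G : SimpleGraph V}
    (hodd : ∀ (v : V) (c : G.Walk v v), c.IsCycle → Odd c.length →
      ∀ i : V, ∃ w ∈ c.support, G.Adj i w)
    (s : ℕ) (a : V → ℕ) (ha : ∀ v w, G.Adj v w → s ≤ a v + a w) :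
    ∃ i, 2 * i ≤ s ∧ ∏ v, (X v : MvPolynomial V K) ^ a v ∈
      (Ideal.span {∏ v, (X v : MvPolynomial V K)}) ^ i * coverIdeal K G ^ (s - 2 * i) := by
  classical
  induction s using Nat.strong_induction_on generalizing a with
  | _ s ih =>
  rcases Nat.eq_zero_or_pos s with rfl | hs
  · exact ⟨0, by simp⟩
  by_cases hfull : 2 ≤ s ∧ ∀ v, 1 ≤ a v
  · obtain ⟨hs2, hfull⟩ := hfull
    obtain ⟨i, hi, hmem⟩ := ih (s - 2) (by omega) (fun v => a v - 1) (fun v w h => by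
      have := ha v w h
      have := hfull v
      have := hfull w
      omega)
    refine ⟨i + 1, by omega, ?_⟩
    have heq : ∏ v, (X v : MvPolynomial V K) ^ a v =
        (∏ v, (X v : MvPolynomial V K)) * ∏ v, (X v : MvPolynomial V K) ^ (a v - 1) := by
      rw [← Finset.prod_mul_distrib]
      exact Finset.prod_congr rfl fun v _ => by
        rw [← pow_succ', Nat.sub_add_cancel (hfull v)]
    rw [heq, pow_succ', mul_assoc, show s - 2 * (i + 1) = s - 2 - 2 * i by omega]
    exact Ideal.mul_mem_mul (Ideal.mem_span_singleton_self _) hmem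
  · obtain ⟨F, b, hF, hab, hb⟩ := exists_isVertexCover_split hs ha (fun v c hc ho => by
      by_cases hall : ∀ v, 1 ≤ a v
      · exact ⟨v, c.start_mem_support, by
          have := hall v
          have : ¬ 2 ≤ s := fun h => hfull ⟨h, hall⟩
          omega⟩
      · push Not at hall
        obtain ⟨i, hi⟩ := hall
        obtain ⟨w, hw, hadj⟩ := hodd v c hc ho i
        exact ⟨w, hw, by have := ha i w hadj; omega⟩)
    obtain ⟨i, hi, hmem⟩ := ih (s - 1) (by omega) b hb
    refine ⟨i, by omega, ?_⟩
    have heq : ∏ v, (X v : MvPolynomial V K) ^ a v =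
        (∏ v ∈ F, (X v : MvPolynomial V K)) * ∏ v, (X v : MvPolynomial V K) ^ b v := by
      simp only [hab, pow_add, Finset.prod_mul_distrib, pow_ite, pow_one, pow_zero,
        Finset.prod_ite_mem, Finset.univ_inter]
    rw [heq, show s - 2 * i = s - 1 - 2 * i + 1 by omega, pow_succ', mul_left_comm]
    exact Ideal.mul_mem_mul (prod_X_mem_coverIdeal K hF) hmem

/-- Polynomials in `(x_v, x_w)^s` only involve monomials of degree at least `s` in `x_v, x_w`. -/
theorem le_add_of_mem_span_pair_pow {V : Type} (v w : V) (s : ℕ) {f : MvPolynomial V K}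
    (hf : f ∈ (Ideal.span {X v, X w} : Ideal (MvPolynomial V K)) ^ s) :
    ∀ m ∈ f.support, s ≤ m v + m w := by
  classical
  induction s generalizing f with
  | zero => simp
  | succ s ih =>
    rw [pow_succ] at hf
    refine Submodule.mul_induction_on hf (fun p hp q hq m hm => ?_) (fun p q hp hq m hm => ?_)
    · obtain ⟨m₁, h₁, m₂, h₂, rfl⟩ := Finset.mem_add.1 (support_mul p q hm)
      have hp := ih hp m₁ h₁
      have hq : 1 ≤ m₂ v + m₂ w := by
        rw [← Set.image_pair, mem_ideal_span_X_image] at hq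
        obtain ⟨i, hi, hne⟩ := hq m₂ h₂
        rcases hi with rfl | rfl <;> omega
      simp only [Finsupp.add_apply]
      omega
    · rcases Finset.mem_union.1 (support_add hm) with h | h
      exacts [hp m h, hq m h]

theorem coverIdeal_le_span_pair {V : Type} {G : SimpleGraph V} {v w : V} (h : G.Adj v w) :
    coverIdeal K G ≤ Ideal.span {X v, X w} := by
  rw [coverIdeal, Ideal.span_le]
  rintro _ ⟨F, hF, rfl⟩
  rcases hF.1 v w h with hm | hm
  · exact Ideal.mem_of_dvd _ (Finset.dvd_prod_of_mem _ hm) (Ideal.subset_span (by simp))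
  · exact Ideal.mem_of_dvd _ (Finset.dvd_prod_of_mem _ hm) (Ideal.subset_span (by simp))

theorem span_prod_X_le_span_pair_sq {V : Type} [Fintype V] {v w : V} (h : v ≠ w) :
    Ideal.span {∏ v, (X v : MvPolynomial V K)} ≤ Ideal.span {X v, X w} ^ 2 := by
  classical
  rw [Ideal.span_singleton_le_iff_mem, pow_two]
  refine Ideal.mem_of_dvd _ (Finset.prod_dvd_prod_of_subset {v, w} _ _ (Finset.subset_univ _)) ?_
  rw [Finset.prod_pair h]
  exact Ideal.mul_mem_mul (Ideal.subset_span (by simp)) (Ideal.subset_span (by simp))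

theorem pow_mul_pow_le_symbolicCoverPower {V : Type} [Fintype V] (G : SimpleGraph V) {i s : ℕ}
    (hi : 2 * i ≤ s) :
    (Ideal.span {∏ v, (X v : MvPolynomial V K)}) ^ i * coverIdeal K G ^ (s - 2 * i) ≤
      symbolicCoverPower K G s := by
  refine le_iInf fun v => le_iInf fun w => le_iInf fun h => ?_
  calc _ ≤ (Ideal.span {X v, X w} ^ 2) ^ i * Ideal.span {X v, X w} ^ (s - 2 * i) :=
        Ideal.mul_mono (Ideal.pow_right_mono (span_prod_X_le_span_pair_sq K h.ne) i)
          (Ideal.pow_right_mono (coverIdeal_le_span_pair K h) _)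
    _ = _ := by rw [← pow_mul, ← pow_add, Nat.add_sub_cancel' hi]

theorem symbolicCoverPower_eq_sum
    (n : ℕ) (G : SimpleGraph (Fin n))
    (hodd : ∀ (v : Fin n) (c : G.Walk v v), c.IsCycle → Odd c.length →
      ∀ i : Fin n, ∃ w ∈ c.support, G.Adj i w)
    (s : ℕ) (hs : 1 ≤ s) :
    symbolicCoverPower K G s =
      coverIdeal K G ^ s +
        ∑ i ∈ Finset.Icc 1 (s / 2),
          (Ideal.span {∏ v : Fin n, (X v : MvPolynomial (Fin n) K)}) ^ i *
            coverIdeal K G ^ (s - 2 * i) := by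
  refine le_antisymm (fun f hf => ?_) ?_
  · have hterm : ∀ i, 2 * i ≤ s →
        (Ideal.span {∏ v : Fin n, (X v : MvPolynomial (Fin n) K)}) ^ i *
          coverIdeal K G ^ (s - 2 * i) ≤ coverIdeal K G ^ s +
            ∑ i ∈ Finset.Icc 1 (s / 2),
              (Ideal.span {∏ v : Fin n, (X v : MvPolynomial (Fin n) K)}) ^ i *
                coverIdeal K G ^ (s - 2 * i) := by
      intro i hi
      rcases Nat.eq_zero_or_pos i with rfl | hpos
      · simp
      · exact (Finset.single_le_sum
          (f := fun i => (Ideal.span {∏ v : Fin n, (X v : MvPolynomial (Fin n) K)}) ^ i *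
            coverIdeal K G ^ (s - 2 * i)) (fun _ _ => bot_le)
          (Finset.mem_Icc.2 ⟨hpos, by omega⟩)).trans le_sup_right
    rw [f.as_sum]
    refine Ideal.sum_mem _ fun m hm => ?_
    obtain ⟨i, hi, hmem⟩ := exists_prod_pow_mem K hodd s m fun v w h => by
      refine le_add_of_mem_span_pair_pow K v w s ?_ m hm
      simp only [symbolicCoverPower, Submodule.mem_iInf] at hf
      exact hf v w h
    rw [monomial_eq, Finsupp.prod_fintype _ _ fun _ => pow_zero _]
    exact Ideal.mul_mem_left _ _ (hterm i hi hmem)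
  · refine sup_le ?_ ?_
    · simpa using pow_mul_pow_le_symbolicCoverPower K G (i := 0) (Nat.zero_le s)
    · refine Finset.sum_induction _ (· ≤ symbolicCoverPower K G s) (fun _ _ => sup_le) bot_le
        fun i hi => pow_mul_pow_le_symbolicCoverPower K G ?_
      have := (Finset.mem_Icc.1 hi).2
      omega

end Stmt
end

section
/- Let C be an odd cycle of length n = 2r+1 and J(C) its vertex cover ideal. Then deg(J(C)) = r+1, and Deg(J(C)) equals 4t+2 if n = 6t+3, equals 4t+3 if n = 6t+5, and equals 4t+4 if n = 6t+7, for all integers t ≥ 0. -/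
/-!
STATEMENT 5: Let `C` be an odd cycle of length `n = 2r+1` with vertex cover ideal `J(C)`.
Then `deg J(C) = r + 1` (the minimal degree of a minimal monomial generator), and
`Deg J(C)` (the maximal degree of a minimal monomial generator) equals `4t+2` if
`n = 6t+3`, equals `4t+3` if `n = 6t+5`, and equals `4t+4` if `n = 6t+7`, for all `t ≥ 0`.
-/
open MvPolynomial

namespace Stmt

variable (K : Type) [Field K]

/-- `a` is the exponent vector of an element of the minimal monomial generating set `G(I)`
of the monomial ideal `I`: the monomial `x^a` lies in `I` and no proper monomial divisor
of it lies in `I`. -/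
def IsMonoMinGen {τ : Type} (I : Ideal (MvPolynomial τ K)) (a : τ →₀ ℕ) : Prop :=
  (monomial a (1 : K)) ∈ I ∧
    ∀ b : τ →₀ ℕ, (monomial b (1 : K)) ∈ I → b ≤ a → b = a

/-- The minimal degree `deg I` of an element of the minimal monomial generating set. -/
noncomputable def mindeg {τ : Type} (I : Ideal (MvPolynomial τ K)) : ℕ :=
  sInf { d : ℕ | ∃ a, IsMonoMinGen K I a ∧ a.sum (fun _ e => e) = d }

/-- The maximal degree `Deg I` of an element of the minimal monomial generating set. -/
noncomputable def maxdeg {τ : Type} (I : Ideal (MvPolynomial τ K)) : ℕ :=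
  sSup { d : ℕ | ∃ a, IsMonoMinGen K I a ∧ a.sum (fun _ e => e) = d }

theorem monomial_mem_coverIdeal_iff {V : Type} (G : SimpleGraph V) (b : V →₀ ℕ) :
    monomial b (1 : K) ∈ coverIdeal K G ↔
      ∃ F : Finset V, IsMinimalVertexCover G F ∧ Finsupp.indicator F (fun _ _ => 1) ≤ b := by
  have hspan : coverIdeal K G = Ideal.span ((fun s => monomial s (1 : K)) ''
      {a | ∃ F : Finset V, IsMinimalVertexCover G F ∧ a = Finsupp.indicator F fun _ _ => 1}) := by
    have hprod (F : Finset V) : ∏ v ∈ F, (X v : MvPolynomial V K) =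
        monomial (Finsupp.indicator F fun _ _ => 1) 1 := by
      rw [Finsupp.indicator_eq_sum_single, monomial_sum_one]
      rfl
    unfold coverIdeal
    congr 1
    ext m
    constructor
    · rintro ⟨F, hF, rfl⟩
      exact ⟨_, ⟨F, hF, rfl⟩, (hprod F).symm⟩
    · rintro ⟨_, ⟨F, hF, rfl⟩, rfl⟩
      exact ⟨F, hF, (hprod F).symm⟩
  classical
  rw [hspan, mem_ideal_span_monomial_image, support_monomial, if_neg one_ne_zero]
  simp only [Finset.mem_singleton, forall_eq]
  constructor
  · rintro ⟨_, ⟨F, hF, rfl⟩, hb⟩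
    exact ⟨F, hF, hb⟩
  · rintro ⟨F, hF, hb⟩
    exact ⟨_, ⟨F, hF, rfl⟩, hb⟩

theorem indicator_one_le_indicator_one_iff {V : Type} (F F' : Finset V) :
    (Finsupp.indicator F fun _ _ => 1 : V →₀ ℕ) ≤ Finsupp.indicator F' (fun _ _ => 1) ↔
      F ⊆ F' := by
  classical
  constructor
  · intro h v hv
    by_contra hv'
    have := h v
    simp [Finsupp.indicator_apply, hv, hv'] at this
  · intro h v
    by_cases hv : v ∈ F
    · simp [Finsupp.indicator_apply, hv, h hv]
    · simp [Finsupp.indicator_apply, hv]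

theorem isMonoMinGen_coverIdeal_iff {V : Type} (G : SimpleGraph V) (a : V →₀ ℕ) :
    IsMonoMinGen K (coverIdeal K G) a ↔
      ∃ F : Finset V, IsMinimalVertexCover G F ∧ a = Finsupp.indicator F fun _ _ => 1 := by
  unfold IsMonoMinGen
  simp only [monomial_mem_coverIdeal_iff]
  constructor
  · rintro ⟨⟨F, hF, hle⟩, hmin⟩
    exact ⟨F, hF, (hmin _ ⟨F, hF, le_rfl⟩ hle).symm⟩
  · rintro ⟨F, hF, rfl⟩
    refine ⟨⟨F, hF, le_rfl⟩, ?_⟩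
    rintro b ⟨F', hF', hle⟩ hb
    have hFF' := hF.2 F' ((indicator_one_le_indicator_one_iff F' F).1 (hle.trans hb)) hF'.1
    subst hFF'
    exact le_antisymm hb hle

theorem setOf_degree_minGen_coverIdeal {V : Type} (G : SimpleGraph V) :
    {d : ℕ | ∃ a, IsMonoMinGen K (coverIdeal K G) a ∧ a.sum (fun _ e => e) = d} =
      {d | ∃ F : Finset V, IsMinimalVertexCover G F ∧ F.card = d} := by
  have hsum (F : Finset V) :
      (Finsupp.indicator F fun _ _ => 1 : V →₀ ℕ).sum (fun _ e => e) = F.card := by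
    classical
    rw [Finsupp.sum_of_support_subset _ (Finsupp.support_indicator_subset F _) _ (by simp)]
    rw [Finset.sum_congr rfl fun v hv => Finsupp.indicator_of_mem hv _]
    simp
  ext d
  simp only [isMonoMinGen_coverIdeal_iff, Set.mem_ofPred_eq]
  constructor
  · rintro ⟨_, ⟨F, hF, rfl⟩, hd⟩
    exact ⟨F, hF, (hsum F).symm.trans hd⟩
  · rintro ⟨F, hF, hd⟩
    exact ⟨_, ⟨F, hF, rfl⟩, (hsum F).trans hd⟩

theorem isVertexCover_cycleGraph_iff {n : ℕ} (F : Finset (Fin (n + 2))) :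
    IsVertexCover (SimpleGraph.cycleGraph (n + 2)) F ↔ ∀ i, i ∈ F ∨ i + 1 ∈ F := by
  constructor
  · intro h i
    exact h i (i + 1) (by simp [SimpleGraph.cycleGraph_adj])
  · intro h v w hvw
    rcases SimpleGraph.cycleGraph_adj.1 hvw with e | e
    · obtain rfl := sub_eq_iff_eq_add'.1 e
      exact (h w).symm
    · obtain rfl := sub_eq_iff_eq_add'.1 e
      exact h v

theorem isMinimalVertexCover_cycleGraph_iff {n : ℕ} (F : Finset (Fin (n + 2))) :
    IsMinimalVertexCover (SimpleGraph.cycleGraph (n + 2)) F ↔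
      (∀ i, i ∈ F ∨ i + 1 ∈ F) ∧ ∀ i, ¬ (i ∈ F ∧ i + 1 ∈ F ∧ i + 1 + 1 ∈ F) := by
  unfold IsMinimalVertexCover
  simp only [isVertexCover_cycleGraph_iff]
  refine and_congr_right fun hF => ⟨fun hmin i ⟨h0, h1, h2⟩ => ?_, fun h F' hsub hF' => ?_⟩
  · have := hmin (F.erase (i + 1)) (Finset.erase_subset _ _) fun j => by
      by_cases hj : j = i + 1
      · subst hj
        simp [h2]
      · by_cases hj' : j = i
        · subst hj'
          simp [h0]
        · simpa [hj, hj'] using hF j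
    exact Finset.notMem_erase (i + 1) F (this.symm ▸ h1)
  · refine hsub.antisymm fun x hx => ?_
    by_contra hx'
    have h1 := (hF' x).resolve_left hx'
    have h0 := (hF' (x - 1)).resolve_right (by simpa using hx')
    exact h (x - 1) ⟨hsub h0, by simpa using hx, by simpa using hsub h1⟩

theorem sum_ite_mem_add_one {n : ℕ} (F : Finset (Fin (n + 2))) :
    ∑ i, (if i + 1 ∈ F then 1 else 0) = F.card := by
  exact (Equiv.sum_comp (Equiv.addRight (1 : Fin (n + 2))) fun i => if i ∈ F then 1 else 0).trans
    (by simp)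

theorem le_two_mul_card_of_cover {n : ℕ} (F : Finset (Fin (n + 2)))
    (h : ∀ i, i ∈ F ∨ i + 1 ∈ F) : n + 2 ≤ 2 * F.card := by
  have hle : ∑ _i : Fin (n + 2), 1 ≤
      ∑ i, ((if i ∈ F then 1 else 0) + if i + 1 ∈ F then 1 else 0) :=
    Finset.sum_le_sum fun i _ => by rcases h i with h | h <;> simp [h]
  rw [Finset.sum_add_distrib, sum_ite_mem_add_one] at hle
  simp at hle
  omega

theorem three_mul_card_le_of_no_three_consecutive {n : ℕ} (F : Finset (Fin (n + 2)))
    (h : ∀ i, ¬ (i ∈ F ∧ i + 1 ∈ F ∧ i + 1 + 1 ∈ F)) : 3 * F.card ≤ 2 * (n + 2) := by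
  have hle : ∑ i : Fin (n + 2), ((if i ∈ F then 1 else 0) + (if i + 1 ∈ F then 1 else 0) +
      if i + 1 + 1 ∈ F then 1 else 0) ≤ ∑ _i : Fin (n + 2), 2 :=
    Finset.sum_le_sum fun i _ => by
      have := h i
      split_ifs <;> simp_all
  have hshift : ∑ i, (if i + 1 + 1 ∈ F then 1 else 0) = F.card :=
    (Equiv.sum_comp (Equiv.addRight (1 : Fin (n + 2))) fun i => if i + 1 ∈ F then 1 else 0).trans
      (sum_ite_mem_add_one F)
  rw [Finset.sum_add_distrib, Finset.sum_add_distrib, hshift, sum_ite_mem_add_one] at hle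
  simp at hle
  omega

theorem val_add_one_cases {n : ℕ} (i : Fin (n + 2)) :
    (i.val + 1 < n + 2 ∧ (i + 1).val = i.val + 1) ∨ (i.val + 1 = n + 2 ∧ (i + 1).val = 0) := by
  rw [Fin.val_add_one]
  split_ifs with h
  · simp [h]
  · have := Fin.val_lt_last h
    omega

theorem exists_minimalVertexCover_cycleGraph (n : ℕ) (p : ℕ → Prop) [DecidablePred p]
    (hcover : ∀ i j, i < n + 2 → (i + 1 < n + 2 ∧ j = i + 1 ∨ i + 1 = n + 2 ∧ j = 0) →
      p i ∨ p j)
    (hmin : ∀ i j k, i < n + 2 → (i + 1 < n + 2 ∧ j = i + 1 ∨ i + 1 = n + 2 ∧ j = 0) →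
      (j + 1 < n + 2 ∧ k = j + 1 ∨ j + 1 = n + 2 ∧ k = 0) → ¬ (p i ∧ p j ∧ p k)) :
    ∃ F : Finset (Fin (n + 2)), IsMinimalVertexCover (SimpleGraph.cycleGraph (n + 2)) F ∧
      F.card = Nat.count p (n + 2) := by
  refine ⟨Finset.univ.filter fun i => p i.val, ?_, ?_⟩
  · rw [isMinimalVertexCover_cycleGraph_iff]
    simp only [Finset.mem_filter, Finset.mem_univ, true_and]
    exact ⟨fun i => hcover _ _ i.isLt (val_add_one_cases i),
      fun i => hmin _ _ _ i.isLt (val_add_one_cases i) (val_add_one_cases (i + 1))⟩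
  · rw [Nat.count_eq_card_filter_range, ← Finset.card_map Fin.valEmbedding]
    congr 1
    ext i
    simpa [Fin.exists_iff] using and_comm

theorem count_even (n : ℕ) : Nat.count (fun i => i % 2 = 0) n = (n + 1) / 2 := by
  induction n with
  | zero => simp
  | succ n ih =>
    rw [Nat.count_succ, ih]
    split_ifs <;> omega

theorem count_not_dvd_three (n : ℕ) : Nat.count (fun i => i % 3 ≠ 0) n = 2 * n / 3 := by
  induction n with
  | zero => simp
  | succ n ih =>
    rw [Nat.count_succ, ih]
    have : n % 3 = 0 ∨ n % 3 = 1 ∨ n % 3 = 2 := by omega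
    split_ifs <;> rcases this with h | h | h <;> omega

/-- The cover of a cycle of length `n ≡ 1 mod 3` whose complement is `{0, 2, 4, 7, 10, …}`
attains the maximal cardinality. -/
theorem count_gap_pattern (n : ℕ) (hn : 4 ≤ n) :
    Nat.count (fun i => i ≠ 0 ∧ i ≠ 2 ∧ (4 ≤ i → i % 3 ≠ 1)) n = n - 2 - (n - 2) / 3 := by
  induction n, hn using Nat.le_induction with
  | base => decide
  | succ n hn ih =>
    rw [Nat.count_succ, ih]
    split_ifs <;> omega

theorem exists_minimalVertexCover_card_two_mul_div_three (n : ℕ) :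
    ∃ F : Finset (Fin (n + 2)), IsMinimalVertexCover (SimpleGraph.cycleGraph (n + 2)) F ∧
      F.card = 2 * (n + 2) / 3 := by
  by_cases hmod : (n + 2) % 3 = 1
  · obtain ⟨F, hF, hcard⟩ := exists_minimalVertexCover_cycleGraph n
      (fun i => i ≠ 0 ∧ i ≠ 2 ∧ (4 ≤ i → i % 3 ≠ 1)) (by intros; omega) (by intros; omega)
    refine ⟨F, hF, ?_⟩
    rw [hcard, count_gap_pattern _ (by omega)]
    omega
  · obtain ⟨F, hF, hcard⟩ := exists_minimalVertexCover_cycleGraph n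
      (fun i => i % 3 ≠ 0) (by intros; omega) (by intros; omega)
    exact ⟨F, hF, hcard.trans (count_not_dvd_three _)⟩

theorem mindeg_coverIdeal_cycleGraph_odd (k : ℕ) :
    mindeg K (coverIdeal K (SimpleGraph.cycleGraph (2 * k + 1 + 2))) = k + 2 := by
  unfold mindeg
  rw [setOf_degree_minGen_coverIdeal]
  refine IsLeast.csInf_eq ⟨?_, ?_⟩
  · obtain ⟨F, hF, hcard⟩ := exists_minimalVertexCover_cycleGraph (2 * k + 1)
      (fun i => i % 2 = 0) (by intros; omega) (by intros; omega)
    refine ⟨F, hF, ?_⟩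
    rw [hcard, count_even]
    omega
  · rintro _ ⟨F, hF, rfl⟩
    have := le_two_mul_card_of_cover F ((isMinimalVertexCover_cycleGraph_iff F).1 hF).1
    omega

theorem maxdeg_coverIdeal_cycleGraph (n : ℕ) :
    maxdeg K (coverIdeal K (SimpleGraph.cycleGraph (n + 2))) = 2 * (n + 2) / 3 := by
  unfold maxdeg
  rw [setOf_degree_minGen_coverIdeal]
  refine IsGreatest.csSup_eq ⟨exists_minimalVertexCover_card_two_mul_div_three n, ?_⟩
  rintro _ ⟨F, hF, rfl⟩
  have := three_mul_card_le_of_no_three_consecutive F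
    ((isMinimalVertexCover_cycleGraph_iff F).1 hF).2
  omega

theorem deg_coverIdeal_oddCycle (r : ℕ) (hr : 1 ≤ r) :
    mindeg K (coverIdeal K (SimpleGraph.cycleGraph (2 * r + 1))) = r + 1 ∧
    ∀ t : ℕ,
      (2 * r + 1 = 6 * t + 3 →
        maxdeg K (coverIdeal K (SimpleGraph.cycleGraph (2 * r + 1))) = 4 * t + 2) ∧
      (2 * r + 1 = 6 * t + 5 →
        maxdeg K (coverIdeal K (SimpleGraph.cycleGraph (2 * r + 1))) = 4 * t + 3) ∧
      (2 * r + 1 = 6 * t + 7 →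
        maxdeg K (coverIdeal K (SimpleGraph.cycleGraph (2 * r + 1))) = 4 * t + 4) := by
  obtain ⟨k, rfl⟩ := Nat.exists_eq_add_of_le' hr
  have hn : 2 * (k + 1) + 1 = 2 * k + 1 + 2 := by ring
  rw [hn]
  refine ⟨mindeg_coverIdeal_cycleGraph_odd K k, fun t => ?_⟩
  rw [maxdeg_coverIdeal_cycleGraph K (2 * k + 1)]
  omega

end Stmt
end

section
/- If a monomial ideal I in R=K[x_1,...,x_n] (not necessarily generated in one degree) is weakly polymatroidal, then I has linear quotients. -/
/-!
STATEMENT 8: If a monomial ideal `I` of `R = K[x_1,…,x_n]` (not necessarily generated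
in one degree) is weakly polymatroidal, then `I` has linear quotients, i.e. its minimal
monomial generators can be ordered `u_1,…,u_m` so that each colon ideal
`(u_1,…,u_{i-1}) : (u_i)` is generated by variables.
-/

open MvPolynomial

namespace Stmt

variable (K : Type) [Field K]

/-- A monomial ideal `I` (not necessarily generated in one degree) is weakly polymatroidal
with respect to a strict order `lt` on the variables (where `lt p q` means that the
variable `x_p` precedes, i.e. is greater than, the variable `x_q`):  for all exponent
vectors `a b` of minimal monomial generators `u = x^a`, `v = x^b` of `I`, if `a` and `b`
agree on all variables preceding `q` and `a q < b q`, then there is a variable `p`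
coming after `q` such that `x_q · u / x_p` is again a minimal monomial generator. -/
def WeaklyPolymatroidalWrt {τ : Type} [DecidableEq τ] (lt : τ → τ → Prop)
    (I : Ideal (MvPolynomial τ K)) : Prop :=
  ∀ a b : τ →₀ ℕ, IsMonoMinGen K I a → IsMonoMinGen K I b →
    ∀ q : τ, (∀ p, lt p q → a p = b p) → a q < b q →
      ∃ p, lt q p ∧ 0 < a p ∧
        IsMonoMinGen K I (a + Finsupp.single q 1 - Finsupp.single p 1)

/-- `I` is a monomial ideal: it is generated by (monic) monomials. -/
def IsMonomialIdeal {τ : Type} (I : Ideal (MvPolynomial τ K)) : Prop :=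
  ∃ S : Set (τ →₀ ℕ),
    I = Ideal.span ((fun a => (monomial a (1 : K) : MvPolynomial τ K)) '' S)

/-- `I` has linear quotients: its minimal monomial generators can be listed as
`u_0, …, u_{m-1}` so that for every `i > 0` the colon ideal
`(u_0, …, u_{i-1}) : (u_i)` is generated by variables. -/
def HasLinearQuotients {τ : Type} [DecidableEq τ] (I : Ideal (MvPolynomial τ K)) : Prop :=
  ∃ (m : ℕ) (u : Fin m → (τ →₀ ℕ)),
    Function.Injective u ∧
    (∀ i, IsMonoMinGen K I (u i)) ∧
    (∀ a, IsMonoMinGen K I a → ∃ i, u i = a) ∧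
    ∀ i : Fin m, 0 < (i : ℕ) →
      ∃ Vs : Set τ,
        Submodule.colon
          (Ideal.span { w | ∃ j, j < i ∧ w = (monomial (u j) (1 : K) : MvPolynomial τ K) })
          (Ideal.span {(monomial (u i) (1 : K) : MvPolynomial τ K)}) =
        Ideal.span ((fun v => (X v : MvPolynomial τ K)) '' Vs)

variable {K}

/-- A monomial `x^a` multiplies `r` into a monomial ideal exactly when every exponent vector
of `r`, shifted by `a`, dominates some generator. -/
lemma mul_monomial_mem_span_iff {τ : Type} {S : Set (τ →₀ ℕ)} {a : τ →₀ ℕ}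
    {r : MvPolynomial τ K} :
    r * monomial a (1 : K) ∈
        Ideal.span ((fun b => (monomial b (1 : K) : MvPolynomial τ K)) '' S) ↔
      ∀ m ∈ r.support, ∃ b ∈ S, b ≤ m + a := by
  classical
  rw [mem_ideal_span_monomial_image]
  constructor
  · intro h m hm
    refine h (m + a) ?_
    rw [mem_support_iff] at hm ⊢
    rwa [coeff_mul_monomial, mul_one]
  · intro h x hx
    rw [mem_support_iff, coeff_mul_monomial'] at hx
    split_ifs at hx with hax
    · obtain ⟨b, hb, hle⟩ := h (x - a) (mem_support_iff.2 (by simpa using hx))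
      exact ⟨b, hb, by rwa [tsub_add_cancel_of_le hax] at hle⟩
    · exact absurd rfl hx

/-- The colon of a monomial ideal by a monomial `x^a` is generated by variables as soon as
every generator `x^b` admits a variable `x_q` dividing `x^b / gcd(x^b, x^a)` such that
`x_q x^a` lies in the ideal. -/
lemma exists_colon_span_eq_span_X {τ : Type} {S : Set (τ →₀ ℕ)} {a : τ →₀ ℕ}
    (h : ∀ b ∈ S, ∃ q, a q < b q ∧ ∃ c ∈ S, c ≤ a + Finsupp.single q 1) :
    ∃ Vs : Set τ,
      Submodule.colon
        (Ideal.span ((fun b => (monomial b (1 : K) : MvPolynomial τ K)) '' S))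
        (Ideal.span {(monomial a (1 : K) : MvPolynomial τ K)}) =
      Ideal.span ((fun v => (X v : MvPolynomial τ K)) '' Vs) := by
  refine ⟨{q | ∃ c ∈ S, c ≤ a + Finsupp.single q 1}, ?_⟩
  ext r
  rw [Ideal.mem_colon_span_singleton, mul_monomial_mem_span_iff, mem_ideal_span_X_image]
  refine forall₂_congr fun m _ => ⟨?_, ?_⟩
  · rintro ⟨b, hb, hle⟩
    obtain ⟨q, hq, hc⟩ := h b hb
    refine ⟨q, hc, ?_⟩
    have := hle q
    rw [Finsupp.add_apply] at this
    omega
  · rintro ⟨q, ⟨c, hc, hle⟩, hq⟩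
    refine ⟨c, hc, hle.trans ?_⟩
    rw [add_comm]
    gcongr
    exact Finsupp.single_le_iff.2 (Nat.one_le_iff_ne_zero.2 hq)

/-- An ideal has only finitely many minimal monomials (Dickson's lemma). -/
lemma finite_setOf_isMonoMinGen {τ : Type} [Finite τ] (I : Ideal (MvPolynomial τ K)) :
    {a | IsMonoMinGen K I a}.Finite := by
  have hanti : IsAntichain (· ≤ ·) {a | IsMonoMinGen K I a} :=
    fun a ha b hb hne hle => hne (hb.2 a ha.1 hle)
  exact hanti.finite_of_partiallyWellOrderedOn (Set.isPWO_of_wellQuasiOrderedLE _)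

lemma lt_toLex_add_single_sub_single {n : ℕ} {a : Fin n →₀ ℕ} {p q : Fin n} (h : q < p) :
    toLex a < toLex (a + Finsupp.single q 1 - Finsupp.single p 1) := by
  rw [Finsupp.Lex.lt_iff]
  refine ⟨q, fun j hj => ?_, ?_⟩
  · simp [hj.ne', (hj.trans h).ne']
  · simp [h.ne']

variable (K)

theorem weaklyPolymatroidal_hasLinearQuotients
    (n : ℕ) (I : Ideal (MvPolynomial (Fin n) K)) (hmono : IsMonomialIdeal K I)
    (hwp : WeaklyPolymatroidalWrt K (· < ·) I) :
    HasLinearQuotients K I := by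
  classical
  let e : (Fin n →₀ ℕ) ≃ (Lex (Fin n →₀ ℕ))ᵒᵈ := toLex.trans OrderDual.toDual
  let s := (finite_setOf_isMonoMinGen I).toFinset.map e.toEmbedding
  let f := s.orderEmbOfFin rfl
  have hs : ∀ x, x ∈ s ↔ IsMonoMinGen K I (e.symm x) := by
    intro x
    simp [s, Finset.mem_map_equiv]
  have hf : ∀ i, IsMonoMinGen K I (e.symm (f i)) := fun i =>
    (hs _).1 (s.orderEmbOfFin_mem rfl i)
  have hsurj : ∀ a, IsMonoMinGen K I a → ∃ i, f i = e a := by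
    intro a ha
    have : e a ∈ Set.range f := by
      rw [Finset.range_orderEmbOfFin, Finset.mem_coe, hs, e.symm_apply_apply]
      exact ha
    exact this
  refine ⟨s.card, fun i => e.symm (f i), e.symm.injective.comp f.injective, hf, ?_, ?_⟩
  · intro a ha
    obtain ⟨i, hi⟩ := hsurj a ha
    exact ⟨i, e.symm_apply_eq.2 hi⟩
  · intro i _
    have himage : {w | ∃ j, j < i ∧ w = (monomial (e.symm (f j)) (1 : K))} =
        (fun b => monomial b (1 : K)) '' ((fun j => e.symm (f j)) '' Set.Iio i) := by
      ext w
      simp [eq_comm]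
    rw [himage]
    refine exists_colon_span_eq_span_X ?_
    rintro _ ⟨j, hj, rfl⟩
    have hlt : toLex (e.symm (f i)) < toLex (e.symm (f j)) := f.lt_iff_lt.2 hj
    obtain ⟨q, hagree, hq⟩ := Finsupp.Lex.lt_iff.1 hlt
    obtain ⟨p, hqp, _, hgen⟩ := hwp _ _ (hf i) (hf j) q hagree hq
    obtain ⟨k, hk⟩ := hsurj _ hgen
    refine ⟨q, hq, _, ⟨k, ?_, rfl⟩, ?_⟩
    · refine f.lt_iff_lt.1 ?_
      rw [hk]
      exact lt_toLex_add_single_sub_single (a := e.symm (f i)) hqp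
    · simp only [hk, e.symm_apply_apply]
      exact tsub_le_self

end Stmt
end

section
/- Let Δ be a simplicial complex on [n] such that the Alexander dual ideal I_Δ^∨ of its Stanley–Reisner ideal is weakly polymatroidal in some ordering of the variables. Then Δ is vertex decomposable. -/
/-!
STATEMENT 9: Let `Δ` be a simplicial complex on `[n]` such that the Alexander dual
`I_Δ^∨` of its Stanley–Reisner ideal is weakly polymatroidal in some ordering of the
variables.  Then `Δ` is vertex decomposable.
-/

open MvPolynomial

namespace Stmt

variable (K : Type) [Field K]

/-- The collection `Δ` of finite subsets of `V` is (the set of faces of) a simplicial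
complex: it is closed under passing to subsets. -/
def IsSimplicialComplex {V : Type} (Δ : Finset V → Prop) : Prop :=
  ∀ F G : Finset V, Δ F → G ⊆ F → Δ G

/-- `F` is a facet (maximal face) of `Δ`. -/
def IsFacet {V : Type} (Δ : Finset V → Prop) (F : Finset V) : Prop :=
  Δ F ∧ ∀ G, Δ G → F ⊆ G → F = G

/-- The link of the vertex `x` in `Δ`. -/
def cplxLink {V : Type} [DecidableEq V] (Δ : Finset V → Prop) (x : V) :
    Finset V → Prop :=
  fun F => x ∉ F ∧ Δ (insert x F)

/-- The deletion of the vertex `x` from `Δ`. -/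
def cplxDel {V : Type} (Δ : Finset V → Prop) (x : V) : Finset V → Prop :=
  fun F => x ∉ F ∧ Δ F

/-- Vertex decomposability of a simplicial complex: either `Δ` is a simplex, or it has a
shedding vertex `x` whose link and deletion are both vertex decomposable. -/
inductive VertexDecomposable {V : Type} [DecidableEq V] : (Finset V → Prop) → Prop
  | simplex (Δ : Finset V → Prop) (F : Finset V) (h : ∀ G, Δ G ↔ G ⊆ F) :
      VertexDecomposable Δ
  | shed (Δ : Finset V → Prop) (x : V) (hx : Δ {x})
      (hlink : VertexDecomposable (cplxLink Δ x))
      (hdel : VertexDecomposable (cplxDel Δ x))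
      (hshed : ∀ F, IsFacet (cplxLink Δ x) F → ¬ IsFacet (cplxDel Δ x) F) :
      VertexDecomposable Δ

/-- The Alexander dual ideal of `Δ`, with `Δ` regarded as a complex on the vertex set `W`:
it is generated by the monomials `∏_{v ∈ W \ F} x_v` with `F` a facet of `Δ`. -/
noncomputable def dualIdealIn {V : Type} [DecidableEq V] (W : Finset V)
    (Δ : Finset V → Prop) : Ideal (MvPolynomial V K) :=
  Ideal.span { m | ∃ F, IsFacet Δ F ∧ m = ∏ v ∈ W \ F, X v }

/-- The Alexander dual ideal `I_Δ^∨` of the Stanley–Reisner ideal of `Δ`. -/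
noncomputable def dualIdeal {V : Type} [Fintype V] [DecidableEq V]
    (Δ : Finset V → Prop) : Ideal (MvPolynomial V K) :=
  dualIdealIn K Finset.univ Δ

/-- The combinatorial form of weak polymatroidality of the Alexander dual ideal, in terms of
exchanges between facets. -/
def FacetExchange {V : Type} [DecidableEq V] (lt : V → V → Prop) (Δ : Finset V → Prop) : Prop :=
  ∀ F G : Finset V, IsFacet Δ F → IsFacet Δ G →
    ∀ q, (∀ p, lt p q → (p ∈ F ↔ p ∈ G)) → q ∈ F → q ∉ G →
      ∃ p, lt q p ∧ p ∉ F ∧ IsFacet Δ (insert p (F.erase q))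

section Combinatorics

variable {V : Type}

theorem exists_facet_superset [Finite V] {Δ : Finset V → Prop} {F : Finset V} (hF : Δ F) :
    ∃ G, IsFacet Δ G ∧ F ⊆ G := by
  obtain ⟨G, hFG, hG⟩ := Set.Finite.exists_le_maximal (Set.toFinite {F | Δ F}) hF
  exact ⟨G, ⟨hG.1, fun H hH hGH => le_antisymm hGH (hG.2 hH hGH)⟩, hFG⟩

theorem IsFacet.cplxDel {Δ : Finset V → Prop} {x : V} {F : Finset V} (hF : IsFacet Δ F)
    (hx : x ∉ F) : IsFacet (cplxDel Δ x) F :=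
  ⟨⟨hx, hF.1⟩, fun G hG => hF.2 G hG.2⟩

theorem IsSimplicialComplex.cplxDel {Δ : Finset V → Prop} (hΔ : IsSimplicialComplex Δ) (x : V) :
    IsSimplicialComplex (cplxDel Δ x) :=
  fun _ _ hF hGF => ⟨fun h => hF.1 (hGF h), hΔ _ _ hF.2 hGF⟩

variable [DecidableEq V]

theorem isFacet_cplxLink_iff {Δ : Finset V → Prop} {x : V} {F : Finset V} :
    IsFacet (cplxLink Δ x) F ↔ x ∉ F ∧ IsFacet Δ (insert x F) := by
  constructor
  · rintro ⟨⟨hx, hF⟩, hmax⟩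
    refine ⟨hx, hF, fun G hG hFG => ?_⟩
    have hxG : x ∈ G := hFG (Finset.mem_insert_self x F)
    have h := hmax (G.erase x) ⟨Finset.notMem_erase x G, by rwa [Finset.insert_erase hxG]⟩
      fun y hy => Finset.mem_erase.2
        ⟨fun h => hx (h ▸ hy), hFG (Finset.mem_insert_of_mem hy)⟩
    rw [h, Finset.insert_erase hxG]
  · rintro ⟨hx, hF, hmax⟩
    refine ⟨⟨hx, hF⟩, fun G hG hFG => ?_⟩
    have h := hmax _ hG.2 (Finset.insert_subset_insert x hFG)
    rw [← Finset.erase_insert hx, h, Finset.erase_insert hG.1]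

theorem IsFacet.of_cplxDel {Δ : Finset V → Prop} (hΔ : IsSimplicialComplex Δ) {x : V}
    (hshed : ∀ F, IsFacet (cplxLink Δ x) F → ¬ IsFacet (Stmt.cplxDel Δ x) F)
    {F : Finset V} (hF : IsFacet (Stmt.cplxDel Δ x) F) : IsFacet Δ F := by
  refine ⟨hF.1.2, fun G hG hFG => ?_⟩
  by_cases hxG : x ∈ G
  · have hFG' : F ⊆ G.erase x := fun y hy =>
      Finset.mem_erase.2 ⟨fun h => hF.1.1 (h ▸ hy), hFG hy⟩
    have hFe : F = G.erase x :=
      hF.2 _ ⟨Finset.notMem_erase x G, hΔ G _ hG (Finset.erase_subset x G)⟩ hFG'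
    refine absurd hF (hshed F ⟨⟨hF.1.1, ?_⟩, fun H hH hFH => ?_⟩)
    · rwa [hFe, Finset.insert_erase hxG]
    · exact hF.2 H ⟨hH.1, hΔ _ _ hH.2 (Finset.subset_insert x H)⟩ hFH
  · exact hF.2 G ⟨hxG, hG⟩ hFG

theorem IsSimplicialComplex.cplxLink {Δ : Finset V → Prop} (hΔ : IsSimplicialComplex Δ) (x : V) :
    IsSimplicialComplex (cplxLink Δ x) :=
  fun _ _ hF hGF => ⟨fun h => hF.1 (hGF h), hΔ _ _ hF.2 (Finset.insert_subset_insert x hGF)⟩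

theorem FacetExchange.cplxLink {lt : V → V → Prop} {Δ : Finset V → Prop}
    (h : FacetExchange lt Δ) (x : V) : FacetExchange lt (cplxLink Δ x) := by
  intro F G hF hG q hq hqF hqG
  rw [isFacet_cplxLink_iff] at hF hG
  have hqx : q ≠ x := fun e => hF.1 (e ▸ hqF)
  obtain ⟨p, hp, hpF, hfac⟩ := h _ _ hF.2 hG.2 q
    (fun p hp => by simp [hq p hp]) (by simp [hqF]) (by simp [hqG, hqx])
  rw [Finset.mem_insert, not_or] at hpF
  refine ⟨p, hp, hpF.2, isFacet_cplxLink_iff.2 ⟨?_, ?_⟩⟩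
  · simp [Ne.symm hpF.1, hF.1]
  · rwa [Finset.insert_comm, ← Finset.erase_insert_of_ne (Ne.symm hqx)]

theorem vertexDecomposable_of_facetExchange [Finite V] (lt : V → V → Prop)
    [IsStrictOrder V lt] (Δ : Finset V → Prop) (hΔ : IsSimplicialComplex Δ)
    (hempty : Δ ∅) (hex : FacetExchange lt Δ) : VertexDecomposable Δ := by
  induction hN : {v | Δ {v}}.ncard using Nat.strong_induction_on generalizing Δ with
  | _ N ih =>
  subst hN
  by_cases hdiff : ∃ x, ∃ F G, IsFacet Δ F ∧ IsFacet Δ G ∧ x ∈ F ∧ x ∉ G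
  · obtain ⟨x, ⟨F, G, hF, hG, hxF, hxG⟩, hmin⟩ :=
      (Finite.wellFounded_of_trans_of_irrefl lt).has_min
        {x | ∃ F G, IsFacet Δ F ∧ IsFacet Δ G ∧ x ∈ F ∧ x ∉ G} hdiff
    have hagree : ∀ p, lt p x → ∀ A B, IsFacet Δ A → IsFacet Δ B → (p ∈ A ↔ p ∈ B) :=
      fun p hp A B hA hB =>
        ⟨fun h => by_contra fun h' => hmin p ⟨A, B, hA, hB, h, h'⟩ hp,
          fun h => by_contra fun h' => hmin p ⟨B, A, hB, hA, h, h'⟩ hp⟩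
    have hx : Δ {x} := hΔ F _ hF.1 (by simpa using hxF)
    have hshed : ∀ H, IsFacet (cplxLink Δ x) H → ¬ IsFacet (cplxDel Δ x) H := by
      intro H hH hH'
      rw [isFacet_cplxLink_iff] at hH
      obtain ⟨p, hp, hpH, hfac⟩ := hex _ G hH.2 hG x
        (fun p hp => hagree p hp _ _ hH.2 hG) (Finset.mem_insert_self x H) hxG
      rw [Finset.erase_insert hH.1] at hfac
      rw [Finset.mem_insert, not_or] at hpH
      have h := hH'.2 (insert p H) ⟨by simp [Ne.symm hpH.1, hH.1], hfac.1⟩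
        (Finset.subset_insert p H)
      exact hpH.2 (h ▸ Finset.mem_insert_self p H)
    have hexDel : FacetExchange lt (cplxDel Δ x) := by
      intro A B hA hB q hq hqA hqB
      have hA' := hA.of_cplxDel hΔ hshed
      have hB' := hB.of_cplxDel hΔ hshed
      obtain ⟨p, hp, hpA, hfac⟩ := hex A B hA' hB' q hq hqA hqB
      refine ⟨p, hp, hpA, hfac.cplxDel ?_⟩
      have hxp : x ≠ p := by
        rintro rfl
        exact hqB ((hagree q hp A B hA' hB').1 hqA)
      simp [hxp, hA.1.1]
    have hcard : ∀ Γ : Finset V → Prop, (∀ v, Γ {v} → v ≠ x ∧ Δ {v}) →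
        {v | Γ {v}}.ncard < {v | Δ {v}}.ncard := fun Γ hΓ =>
      Set.ncard_lt_ncard
        ((Set.ssubset_iff_of_subset fun v hv => (hΓ v hv).2).2
          ⟨x, hx, fun h => (hΓ x h).1 rfl⟩) (Set.toFinite _)
    refine .shed Δ x hx ?_ ?_ hshed
    · refine ih _ (hcard _ fun v hv => ?_) _ (hΔ.cplxLink x) ⟨by simp, by simpa using hx⟩
        (hex.cplxLink x) rfl
      exact ⟨fun h => hv.1 (by simp [h]), hΔ _ _ hv.2 (Finset.subset_insert x _)⟩
    · refine ih _ (hcard _ fun v hv => ?_) _ (hΔ.cplxDel x) ⟨by simp, hempty⟩ hexDel rfl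
      exact ⟨fun h => hv.1 (by simp [h]), hv.2⟩
  · push Not at hdiff
    obtain ⟨F, hF, -⟩ := exists_facet_superset hempty
    refine .simplex Δ F fun G => ⟨fun hG => ?_, hΔ F G hF.1⟩
    obtain ⟨H, hH, hGH⟩ := exists_facet_superset hG
    exact fun v hv => hdiff v H F hH hF (hGH hv)

end Combinatorics

section DualIdeal

variable {V : Type} [Fintype V] [DecidableEq V]

/-- The exponent vector of the monomial `∏_{v ∉ F} x_v`. -/
noncomputable def complExponent (F : Finset V) : V →₀ ℕ :=
  Finsupp.equivFunOnFinite.symm fun v => if v ∈ F then 0 else 1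

theorem complExponent_apply (F : Finset V) (v : V) :
    complExponent F v = if v ∈ F then 0 else 1 := rfl

theorem complExponent_le_iff {F G : Finset V} :
    complExponent F ≤ complExponent G ↔ G ⊆ F := by
  refine ⟨fun h v hv => ?_, fun h v => ?_⟩
  · have := h v
    by_contra hvF
    simp [complExponent_apply, hv, hvF] at this
  · by_cases hv : v ∈ G
    · simp [complExponent_apply, hv, h hv]
    · by_cases hvF : v ∈ F <;> simp [complExponent_apply, hv, hvF]

theorem complExponent_injective : Function.Injective (complExponent (V := V)) := fun _ _ h =>
  Finset.Subset.antisymm (complExponent_le_iff.1 h.ge) (complExponent_le_iff.1 h.le)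

theorem prod_X_sdiff_eq (F : Finset V) :
    ∏ v ∈ Finset.univ \ F, (X v : MvPolynomial V K) = monomial (complExponent F) 1 := by
  rw [monomial_eq, C_1, one_mul, Finsupp.prod_fintype _ _ (by simp),
    ← Finset.prod_subset (Finset.subset_univ (Finset.univ \ F))]
  · exact Finset.prod_congr rfl fun v hv => by simp_all [complExponent_apply]
  · intro v _ hv
    simp_all [complExponent_apply]

theorem monomial_mem_dualIdeal_iff (Δ : Finset V → Prop) (a : V →₀ ℕ) :
    monomial a (1 : K) ∈ dualIdeal K Δ ↔ ∃ F, IsFacet Δ F ∧ complExponent F ≤ a := by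
  have h : dualIdeal K Δ = Ideal.span
      ((fun s => monomial s (1 : K)) '' (complExponent '' {F | IsFacet Δ F})) := by
    unfold dualIdeal dualIdealIn
    congr 1
    ext m
    simp [prod_X_sdiff_eq, eq_comm]
  rw [h, mem_ideal_span_monomial_image]
  simp

theorem isMonoMinGen_dualIdeal_iff (Δ : Finset V → Prop) (a : V →₀ ℕ) :
    IsMonoMinGen K (dualIdeal K Δ) a ↔ ∃ F, IsFacet Δ F ∧ a = complExponent F := by
  unfold IsMonoMinGen
  simp only [monomial_mem_dualIdeal_iff]
  constructor
  · rintro ⟨⟨F, hF, hFa⟩, hmin⟩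
    exact ⟨F, hF, (hmin _ ⟨F, hF, le_rfl⟩ hFa).symm⟩
  · rintro ⟨F, hF, rfl⟩
    refine ⟨⟨F, hF, le_rfl⟩, ?_⟩
    rintro b ⟨G, hG, hGb⟩ hbF
    have hFG : F = G := hF.2 G hG.1 (complExponent_le_iff.1 (hGb.trans hbF))
    subst hFG
    exact le_antisymm hbF hGb

theorem complExponent_add_single_sub_single {F : Finset V} {p q : V} (hp : p ∉ F) (hq : q ∈ F) :
    complExponent F + Finsupp.single q 1 - Finsupp.single p 1 =
      complExponent (insert p (F.erase q)) := by
  have hpq : p ≠ q := fun h => hp (h ▸ hq)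
  ext v
  simp only [Finsupp.tsub_apply, Finsupp.add_apply, complExponent_apply, Finsupp.single_apply,
    Finset.mem_insert, Finset.mem_erase]
  grind

theorem WeaklyPolymatroidalWrt.facetExchange {lt : V → V → Prop} {Δ : Finset V → Prop}
    (h : WeaklyPolymatroidalWrt K lt (dualIdeal K Δ)) : FacetExchange lt Δ := by
  intro F G hF hG q hq hqF hqG
  obtain ⟨p, hp, hpos, hgen⟩ := h (complExponent F) (complExponent G)
    ((isMonoMinGen_dualIdeal_iff K Δ _).2 ⟨F, hF, rfl⟩)
    ((isMonoMinGen_dualIdeal_iff K Δ _).2 ⟨G, hG, rfl⟩) q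
    (fun p hp => by simp [complExponent_apply, hq p hp])
    (by simp [complExponent_apply, hqF, hqG])
  have hpF : p ∉ F := fun hpF => by simp [complExponent_apply, hpF] at hpos
  rw [complExponent_add_single_sub_single hpF hqF, isMonoMinGen_dualIdeal_iff] at hgen
  obtain ⟨H, hH, hHeq⟩ := hgen
  exact ⟨p, hp, hpF, complExponent_injective hHeq ▸ hH⟩

end DualIdeal

theorem vertexDecomposable_of_weaklyPolymatroidal
    (n : ℕ) (Δ : Finset (Fin n) → Prop)
    (hΔ : IsSimplicialComplex Δ) (hempty : Δ ∅)
    (hwp : ∃ r : LinearOrder (Fin n), WeaklyPolymatroidalWrt K r.lt (dualIdeal K Δ)) :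
    VertexDecomposable Δ := by
  obtain ⟨r, hr⟩ := hwp
  have : IsStrictOrder (Fin n) r.lt := (@instIsStrictTotalOrderLt (Fin n) r).toIsStrictOrder
  exact vertexDecomposable_of_facetExchange r.lt Δ hΔ hempty (hr.facetExchange K)

end Stmt
end
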